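/- Let F be a prime field of order p, 0 < β ≤ α < n, and let μ be the measure μ = (1_E + 1_A)/(|E|+|A|) from the sharpness construction. Then for all 1 ≤ p₀ < ∞, taking f = 1_A, the extension constant satisfies R*(p₀ → q) ≥ c·p^{(2n−2α+β−qβ)/(2q) + β/(2p₀)}. Consequently, if μ is a probability measure on F^n satisfying μ(x) ≲ p^{−α} and |μ̂(ξ)| ≲ p^{−β/2} (ξ ≠ 0), a uniform bound R*(p₀ → q) ≲ 1 can only hold when q ≥ p₀(2n − 2α + β)/((p₀ − 1)β) for 1 < p₀ < ∞, q ≥ (2n − 2α + β)/β for p₀ = ∞, and q = ∞ for p₀ = 1. -/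

import Mathlib

open Finset MeasureTheory ENNReal

noncomputable def e (p : ℕ) (t : ZMod p) : ℂ :=
  Complex.exp (2 * Real.pi * Complex.I * (t.val : ℂ) / (p : ℂ))

noncomputable def dft {p n : ℕ} [NeZero p] (f : (Fin n → ZMod p) → ℂ)
    (ξ : Fin n → ZMod p) : ℂ :=
  ∑ x : Fin n → ZMod p, e p (-(∑ i, x i * ξ i)) * f x

def cubeA (p n N : ℕ) : Finset (Fin n → ZMod p) :=
  Fintype.piFinset fun _ => (Finset.Icc 1 N).image (fun k : ℕ => (k : ZMod p))

noncomputable def combMeasure (p n N : ℕ) (E : Finset (Fin n → ZMod p))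
    (x : Fin n → ZMod p) : ℝ :=
  ((if x ∈ E then 1 else 0) + (if x ∈ cubeA p n N then 1 else 0)) /
    ((E.card : ℝ) + ((cubeA p n N).card : ℝ))

instance (p n : ℕ) : MeasurableSpace (Fin n → ZMod p) := ⊤

lemma e_eq (p : ℕ) [NeZero p] (t : ZMod p) : e p t = ZMod.stdAddChar t := by
  rw [ZMod.stdAddChar_apply, ZMod.toCircle_apply, e]

lemma norm_e (p : ℕ) [NeZero p] (t : ZMod p) : ‖e p t‖ = 1 := by
  rw [e_eq, ZMod.stdAddChar_apply, Circle.norm_coe]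

lemma re_e_lower (p m : ℕ) [NeZero p] (h : 10 * m ≤ p) :
    1 / 2 ≤ (e p (-(m : ZMod p))).re := by
  have hp : (0 : ℝ) < p := by exact_mod_cast Nat.pos_of_ne_zero (NeZero.ne p)
  have h1 : (-(m : ZMod p)) = (((-(m : ℤ)) : ℤ) : ZMod p) := by push_cast; rfl
  have h2 : (2 * Real.pi * Complex.I * ((-(m : ℤ) : ℤ) : ℂ) / (p : ℂ))
      = ((-(2 * Real.pi * m / p) : ℝ) : ℂ) * Complex.I := by
    push_cast; ring
  rw [e_eq, h1, ZMod.stdAddChar_coe, h2, Complex.exp_ofReal_mul_I_re, Real.cos_neg,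
    ← Real.cos_pi_div_three]
  have hm : (10 : ℝ) * m ≤ p := by exact_mod_cast h
  apply Real.cos_le_cos_of_nonneg_of_le_pi
  · positivity
  · linarith [Real.pi_pos]
  · rw [div_le_div_iff₀ hp (by norm_num)]
    nlinarith [Real.pi_pos]

lemma card_cubeA (p n N : ℕ) (h : N < p) : (cubeA p n N).card = N ^ n := by
  rw [cubeA, Fintype.card_piFinset]
  rw [Finset.prod_const, Finset.card_image_of_injOn]
  · simp
  · intro a ha b hb hab
    simp only [Finset.coe_Icc, Set.mem_Icc] at ha hb
    have := (ZMod.natCast_eq_natCast_iff' a b p).1 hab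
    rwa [Nat.mod_eq_of_lt (by omega), Nat.mod_eq_of_lt (by omega)] at this

lemma mem_cubeA {p n N : ℕ} {x : Fin n → ZMod p} (h : x ∈ cubeA p n N) :
    ∃ k : Fin n → ℕ, (∀ i, k i ≤ N) ∧ ∀ i, x i = (k i : ZMod p) := by
  rw [cubeA, Fintype.mem_piFinset] at h
  have : ∀ i, ∃ k : ℕ, k ≤ N ∧ x i = (k : ZMod p) := by
    intro i
    obtain ⟨k, hk, hk'⟩ := Finset.mem_image.1 (h i)
    exact ⟨k, (Finset.mem_Icc.1 hk).2, hk'.symm⟩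
  choose k hk using this
  exact ⟨k, fun i => (hk i).1, fun i => (hk i).2⟩

lemma re_e_cube {p n N K : ℕ} [NeZero p] (h : 10 * n * N * K ≤ p)
    {x ξ : Fin n → ZMod p} (hx : x ∈ cubeA p n N) (hξ : ξ ∈ cubeA p n K) :
    1 / 2 ≤ (e p (-(∑ i, x i * ξ i))).re := by
  obtain ⟨k, hk, hkx⟩ := mem_cubeA hx
  obtain ⟨l, hl, hlx⟩ := mem_cubeA hξ
  have : (∑ i, x i * ξ i) = ((∑ i, k i * l i : ℕ) : ZMod p) := by
    push_cast
    exact Finset.sum_congr rfl fun i _ => by rw [hkx, hlx]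
  rw [this]
  apply re_e_lower
  have : ∑ i, k i * l i ≤ ∑ _i : Fin n, N * K :=
    Finset.sum_le_sum fun i _ => Nat.mul_le_mul (hk i) (hl i)
  simp only [Finset.sum_const, Finset.card_univ, Fintype.card_fin, smul_eq_mul] at this
  nlinarith

lemma dft_lower {p n N K : ℕ} [NeZero p] (h : 10 * n * N * K ≤ p)
    (w : (Fin n → ZMod p) → ℝ) (hw : ∀ x, 0 ≤ w x)
    {ξ : Fin n → ZMod p} (hξ : ξ ∈ cubeA p n K) :
    (∑ x ∈ cubeA p n N, w x) * (1 / 2) ≤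
      ‖dft (fun x => (if x ∈ cubeA p n N then (1 : ℂ) else 0) * w x) ξ‖ := by
  refine le_trans ?_ (Complex.re_le_norm _)
  have : dft (fun x => (if x ∈ cubeA p n N then (1 : ℂ) else 0) * w x) ξ
      = ∑ x ∈ cubeA p n N, e p (-(∑ i, x i * ξ i)) * (w x : ℂ) := by
    rw [dft, ← Finset.sum_filter_add_sum_filter_not Finset.univ (· ∈ cubeA p n N)]
    rw [Finset.sum_eq_zero (s := Finset.univ.filter (¬ · ∈ cubeA p n N)), add_zero]
    · simp only [Finset.filter_univ_mem]
      exact Finset.sum_congr rfl fun x hx => by simp [hx]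
    · intro x hx
      simp [(Finset.mem_filter.1 hx).2]
  rw [this, Complex.re_sum, Finset.sum_mul]
  refine Finset.sum_le_sum fun x hx => ?_
  rw [Complex.re_mul_ofReal, mul_comm]
  exact mul_le_mul_of_nonneg_right (re_e_cube h hx hξ) (hw x)

lemma sum_e_zero {p n : ℕ} [Fact p.Prime] {ξ : Fin n → ZMod p} (hξ : ξ ≠ 0) :
    ∑ x : Fin n → ZMod p, e p (-(∑ i, x i * ξ i)) = 0 := by
  let φ : (Fin n → ZMod p) →+ ZMod p :=
    { toFun := fun x => -(∑ i, x i * ξ i)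
      map_zero' := by simp
      map_add' := by intro x y; simp [add_mul, Finset.sum_add_distrib]; ring }
  let ψ : AddChar (Fin n → ZMod p) ℂ := (ZMod.stdAddChar (N := p)).compAddMonoidHom φ
  have h1 : ∀ x, e p (-(∑ i, x i * ξ i)) = ψ x := fun x => by rw [e_eq]; rfl
  simp_rw [h1]
  rw [AddChar.sum_eq_zero_iff_ne_zero]
  intro h0
  obtain ⟨i, hi⟩ := Function.ne_iff.1 hξ
  have h2 : ψ (Pi.single i (1 : ZMod p)) = 1 := by rw [h0]; rfl
  rw [← h1, e_eq] at h2
  have h3 := ZMod.injective_stdAddChar (h2.trans (AddChar.map_zero_eq_one _).symm)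
  simp [Pi.single_apply] at h3
  exact hi h3

/-- size of the dual cube -/
lemma dual_card (n p N : ℕ) (hn : 1 ≤ n) (hN : 1 ≤ N) (h : 10 * n * N ≤ p)
    (α β c₂ : ℝ) (hc₂ : 0 < c₂) (hu : (N : ℝ) ^ n ≤ c₂ * (p : ℝ) ^ (α - β / 2)) :
    ∃ K : ℕ, 10 * n * N * K ≤ p ∧
      (1 / ((20 * n) ^ n * c₂)) * (p : ℝ) ^ (n - α + β / 2) ≤ ((cubeA p n K).card : ℝ) := by
  have h10 : 0 < 10 * n * N := by positivity
  have hp : 0 < p := by omega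
  have hpR : (0 : ℝ) < p := by exact_mod_cast hp
  refine ⟨p / (10 * n * N), Nat.mul_div_le _ _, ?_⟩
  set K := p / (10 * n * N) with hK
  have hK1 : 1 ≤ K := (Nat.one_le_div_iff h10).2 h
  have hKp : K < p := Nat.div_lt_self hp (by nlinarith [Nat.mul_le_mul hn hN])
  rw [card_cubeA p n K hKp]
  have h1 : p < 10 * n * N * (K + 1) := by
    have := Nat.lt_mul_div_succ p h10
    simpa [hK] using this
  have h2 : p ≤ 20 * n * N * K := by nlinarith
  have h3 : (p : ℝ) ^ n ≤ (20 * n) ^ n * (N : ℝ) ^ n * (K : ℝ) ^ n := by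
    rw [← mul_pow, ← mul_pow]
    exact pow_le_pow_left₀ hpR.le (by exact_mod_cast h2) n
  have hn0 : (0 : ℝ) < n := by exact_mod_cast hn
  have h4 : (p : ℝ) ^ ((n : ℝ) - α + β / 2) * (p : ℝ) ^ (α - β / 2) = (p : ℝ) ^ n := by
    rw [← Real.rpow_add hpR, ← Real.rpow_natCast]; congr 1; ring
  have h5 : 0 < (p : ℝ) ^ (α - β / 2) := Real.rpow_pos_of_pos hpR _
  push_cast
  rw [div_mul_eq_mul_div, one_mul, div_le_iff₀ (by positivity)]
  refine le_of_mul_le_mul_right ?_ h5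
  rw [h4]
  refine h3.trans ?_
  have : (20 * (n : ℝ)) ^ n * (N : ℝ) ^ n * (K : ℝ) ^ n ≤
     (20 * (n : ℝ)) ^ n * (c₂ * (p : ℝ) ^ (α - β / 2)) * (K : ℝ) ^ n := by gcongr
  refine this.trans (le_of_eq (by ring))

lemma power_combine {P M B m b x y s r : ℝ} (hP : 0 < P) (hm : 0 < m) (hb : 0 < b)
    (hM : m * P ^ (-x) ≤ M) (hB : b * P ^ y ≤ B) (hs : s ≤ 1) (hr : 0 ≤ r) :
    (1 / 2 * m ^ (1 - s) * b ^ r) * P ^ (y * r - x * (1 - s)) * M ^ s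
      ≤ M * (1 / 2) * B ^ r := by
  have hx : 0 < P ^ (-x) := Real.rpow_pos_of_pos hP _
  have hy : 0 < P ^ y := Real.rpow_pos_of_pos hP _
  have hM0 : 0 < M := lt_of_lt_of_le (by positivity) hM
  have h1 : M = M ^ (1 - s) * M ^ s := by
    rw [← Real.rpow_add hM0]; simp
  have h2 : m ^ (1 - s) * P ^ (-x * (1 - s)) ≤ M ^ (1 - s) := by
    rw [Real.rpow_mul hP.le, ← Real.mul_rpow hm.le hx.le]
    exact Real.rpow_le_rpow (by positivity) hM (by linarith)
  have h3 : b ^ r * P ^ (y * r) ≤ B ^ r := by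
    rw [Real.rpow_mul hP.le, ← Real.mul_rpow hb.le hy.le]
    exact Real.rpow_le_rpow (by positivity) hB hr
  have h4 : P ^ (y * r - x * (1 - s)) = P ^ (-x * (1 - s)) * P ^ (y * r) := by
    rw [← Real.rpow_add hP]; congr 1; ring
  calc _ = (1 / 2) * (m ^ (1 - s) * P ^ (-x * (1 - s))) * (b ^ r * P ^ (y * r)) * M ^ s := by
        rw [h4]; ring
    _ ≤ (1 / 2) * (M ^ (1 - s)) * (B ^ r) * M ^ s := by gcongr
    _ = (M ^ (1 - s) * M ^ s) * (1 / 2) * B ^ r := by ring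
    _ = _ := by rw [← h1]

lemma part_one (n : ℕ) (α β c₁ c₂ c₄ : ℝ)
    (hβ0 : 0 < β) (hn : 1 ≤ n)
    (hc₁ : 0 < c₁) (hc₂ : 0 < c₂) (hc₄ : 0 < c₄) (p₀ q : ℝ) (hp₀ : 1 ≤ p₀) (hq : 1 ≤ q) :
      ∃ c : ℝ, 0 < c ∧
        ∀ (p N : ℕ) [Fact p.Prime] (E : Finset (Fin n → ZMod p)),
          1 ≤ N → 10 * n * N ≤ p →
          c₁ * (p : ℝ) ^ (α - β / 2) ≤ (N : ℝ) ^ n →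
          (N : ℝ) ^ n ≤ c₂ * (p : ℝ) ^ (α - β / 2) →
          (E.card : ℝ) ≤ c₄ * (p : ℝ) ^ α →
          c * (p : ℝ) ^ ((2 * n - 2 * α + β - q * β) / (2 * q) + β / (2 * p₀)) *
              (∑ x : Fin n → ZMod p,
                ‖(if x ∈ cubeA p n N then (1 : ℂ) else 0)‖ ^ p₀ *
                  combMeasure p n N E x) ^ (1 / p₀)
            ≤ (∑ ξ : Fin n → ZMod p,
                ‖dft (fun x => (if x ∈ cubeA p n N then (1 : ℂ) else 0) *
                    combMeasure p n N E x) ξ‖ ^ q) ^ (1 / q) := by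
  have hn0 : (0 : ℝ) < n := by exact_mod_cast hn
  refine ⟨1 / 2 * (c₁ / (c₄ + c₂)) ^ (1 - 1 / p₀) * (1 / ((20 * n) ^ n * c₂)) ^ (1 / q),
    by positivity, ?_⟩
  intro p N _ E hN h10 hl hu hE
  have hp : 0 < p := (Fact.out : p.Prime).pos
  have hp1 : (1 : ℝ) ≤ p := by exact_mod_cast hp
  have hpR : (0 : ℝ) < p := by exact_mod_cast hp
  have hNp : N < p := by nlinarith [Nat.mul_le_mul hn hN, Nat.mul_le_mul hn (le_refl N)]
  obtain ⟨K, hK, hB⟩ := dual_card n p N hn hN h10 α β c₂ hc₂ hu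
  have hw : ∀ x, 0 ≤ combMeasure p n N E x := by
    intro x; unfold combMeasure; split_ifs <;> positivity
  have hM1 : (∑ x : Fin n → ZMod p,
                ‖(if x ∈ cubeA p n N then (1 : ℂ) else 0)‖ ^ p₀ *
                  combMeasure p n N E x) = ∑ x ∈ cubeA p n N, combMeasure p n N E x := by
    rw [← Finset.sum_filter_add_sum_filter_not Finset.univ (· ∈ cubeA p n N)]
    rw [Finset.sum_eq_zero (s := Finset.univ.filter (¬ · ∈ cubeA p n N)), add_zero]
    · simp only [Finset.filter_univ_mem]
      exact Finset.sum_congr rfl fun x hx => by simp [hx]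
    · intro x hx
      simp [(Finset.mem_filter.1 hx).2, Real.zero_rpow (by linarith : p₀ ≠ 0)]
  rw [hM1]
  set M := ∑ x ∈ cubeA p n N, combMeasure p n N E x with hMdef
  have hM0 : 0 ≤ M := Finset.sum_nonneg fun x _ => hw x
  have hM : (c₁ / (c₄ + c₂)) * (p : ℝ) ^ (-(β / 2)) ≤ M := by
    have hcard : ((cubeA p n N).card : ℝ) = (N : ℝ) ^ n := by
      rw [card_cubeA p n N hNp]; push_cast; rfl
    have hNn : (0 : ℝ) < (N : ℝ) ^ n := by have : (0 : ℝ) < N := by exact_mod_cast hN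
                                           positivity
    have h1 : (N : ℝ) ^ n / ((E.card : ℝ) + (N : ℝ) ^ n) ≤ M := by
      have : ∑ x ∈ cubeA p n N, 1 / ((E.card : ℝ) + (N : ℝ) ^ n) ≤ M := by
        refine Finset.sum_le_sum fun x hx => ?_
        unfold combMeasure
        rw [hcard]
        gcongr
        simp only [hx, if_true]
        split_ifs <;> norm_num
      rw [Finset.sum_const, nsmul_eq_mul, hcard] at this
      simpa [div_eq_mul_inv] using this
    refine le_trans ?_ h1
    have ha : (p : ℝ) ^ (-(β / 2)) * (p : ℝ) ^ α = (p : ℝ) ^ (α - β / 2) := by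
      rw [← Real.rpow_add hpR]; congr 1; ring
    have hb : (p : ℝ) ^ (α - β / 2) ≤ (p : ℝ) ^ α :=
      Real.rpow_le_rpow_of_exponent_le hp1 (by linarith)
    rw [div_mul_eq_mul_div, div_le_div_iff₀ (by positivity) (by positivity)]
    have hpb := Real.rpow_pos_of_pos hpR (-(β / 2))
    calc _ ≤ c₁ * (p : ℝ) ^ (-(β / 2)) * (c₄ * (p : ℝ) ^ α + c₂ * (p : ℝ) ^ α) := by
          gcongr
          exact hu.trans (by gcongr)
      _ = (c₁ * ((p : ℝ) ^ (-(β / 2)) * (p : ℝ) ^ α)) * (c₄ + c₂) := by ring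
      _ ≤ _ := by rw [ha]; gcongr
  have hkey := power_combine (s := 1 / p₀) (r := 1 / q) hpR (by positivity) (by positivity) hM hB
    (by rw [div_le_one (by linarith)]; exact hp₀) (by positivity)
  have hexp : ((n - α + β / 2) * (1 / q) - β / 2 * (1 - 1 / p₀))
      = ((2 * n - 2 * α + β - q * β) / (2 * q) + β / (2 * p₀)) := by
    field_simp; ring
  rw [hexp] at hkey
  refine hkey.trans ?_
  have hq0 : 0 < q := by linarith
  have : M * (1 / 2) * ((cubeA p n K).card : ℝ) ^ (1 / q)
      = (((cubeA p n K).card : ℝ) * (M * (1 / 2)) ^ q) ^ (1 / q) := by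
    rw [Real.mul_rpow (by positivity) (by positivity), ← Real.rpow_mul (by positivity),
      mul_one_div_cancel hq0.ne', Real.rpow_one]; ring
  rw [this]
  apply Real.rpow_le_rpow (by positivity) _ (by positivity)
  rw [← nsmul_eq_mul, ← Finset.sum_const]
  calc _ ≤ ∑ ξ ∈ cubeA p n K, ‖dft (fun x => (if x ∈ cubeA p n N then (1 : ℂ) else 0) *
                    combMeasure p n N E x) ξ‖ ^ q := by
        refine Finset.sum_le_sum fun ξ hξ => ?_
        exact Real.rpow_le_rpow (by positivity) (dft_lower hK _ hw hξ) hq0.le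
    _ ≤ _ := Finset.sum_le_sum_of_subset_of_nonneg (Finset.subset_univ _)
        fun _ _ _ => by positivity

lemma eventually_small (y ε : ℝ) (hy : 0 < y) (hε : 0 < ε) :
    ∀ᶠ p : ℕ in Filter.atTop, (p : ℝ) ^ (-y) ≤ ε := by
  have := (tendsto_rpow_neg_atTop hy).comp (tendsto_natCast_atTop_atTop (R := ℝ))
  exact (this.eventually (ge_mem_nhds hε))

lemma construct (n : ℕ) (α β C : ℝ) (hβ0 : 0 < β) (hβα : β ≤ α) (hαn : α < n) (hn : 1 ≤ n)
    (hC : 0 < C) :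
    ∃ m b : ℝ, 0 < m ∧ 0 < b ∧ ∀ᶠ p : ℕ in Filter.atTop, ∀ _ : Fact p.Prime,
      ∃ (N K : ℕ) (μ : (Fin n → ZMod p) → ℝ),
        10 * n * N * K ≤ p ∧ (∀ x, 0 < μ x) ∧ (∑ x, μ x) = 1 ∧
        (∀ x, μ x ≤ C * (p : ℝ) ^ (-α)) ∧
        (∀ ξ, ξ ≠ 0 → ‖dft (fun x => (μ x : ℂ)) ξ‖ ≤ C * (p : ℝ) ^ (-β / 2)) ∧
        m * (p : ℝ) ^ (-(β / 2)) ≤ ∑ x ∈ cubeA p n N, μ x ∧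
        b * (p : ℝ) ^ (n - α + β / 2) ≤ ((cubeA p n K).card : ℝ) := by
  have hn0 : (0 : ℝ) < n := by exact_mod_cast hn
  set c : ℝ := min C 1 / 2 with hc
  have hc0 : 0 < c := by positivity
  have hcC : c ≤ C / 2 := by have := min_le_left C 1; linarith
  have hc1 : c ≤ 1 / 2 := by have := min_le_right C 1; linarith
  refine ⟨c, 1 / ((20 * n) ^ n * 2 ^ n), hc0, by positivity, ?_⟩
  have ha : 0 < 1 - (α - β / 2) / n := by
    rw [sub_pos, div_lt_one hn0]; linarith
  filter_upwards [eventually_small (n - α) (C / 2) (by linarith) (by linarith),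
    eventually_small _ (1 / (20 * n)) ha (by positivity)] with p h1 h2 hpp
  have hp : 0 < p := (Fact.out : p.Prime).pos
  have hp1 : (1 : ℝ) ≤ p := by exact_mod_cast hp
  have hpR : (0 : ℝ) < p := by exact_mod_cast hp
  set a := (α - β / 2) / n with ha'
  have ha0 : 0 ≤ a := div_nonneg (by linarith) hn0.le
  set X := (p : ℝ) ^ a with hX
  have hX1 : 1 ≤ X := Real.one_le_rpow hp1 ha0
  have hXn : X ^ n = (p : ℝ) ^ (α - β / 2) := by
    rw [hX, ← Real.rpow_natCast, ← Real.rpow_mul hpR.le, ha', div_mul_cancel₀ _ hn0.ne']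
  set N := ⌈X⌉₊ with hNdef
  have hNl : X ≤ N := Nat.le_ceil X
  have hNu : (N : ℝ) ≤ 2 * X := by
    have := Nat.ceil_lt_add_one (by linarith : (0 : ℝ) ≤ X)
    linarith
  have hN1 : 1 ≤ N := Nat.one_le_ceil_iff.2 (by linarith)
  have hXp : 20 * n * X ≤ p := by
    have hh : (p : ℝ) ^ (-(1 - a)) * p = X := by
      rw [hX]
      nth_rewrite 2 [← Real.rpow_one (p : ℝ)]
      rw [← Real.rpow_add hpR]; congr 1; ring
    rw [← hh]
    calc 20 * n * ((p : ℝ) ^ (-(1 - a)) * p) ≤ 20 * n * (1 / (20 * n) * p) := by gcongr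
      _ = p := by field_simp
  have h10 : 10 * n * N ≤ p := by
    have : (10 : ℝ) * n * N ≤ p := by
      calc (10 : ℝ) * n * N ≤ 10 * n * (2 * X) := by gcongr
        _ = 20 * n * X := by ring
        _ ≤ p := hXp
    exact_mod_cast this
  have hNp : N < p := by nlinarith [Nat.mul_le_mul hn hN1, Nat.mul_le_mul hn (le_refl N)]
  have hcard : ((cubeA p n N).card : ℝ) = (N : ℝ) ^ n := by
    rw [card_cubeA p n N hNp]; push_cast; rfl
  have hNnl : (p : ℝ) ^ (α - β / 2) ≤ (N : ℝ) ^ n := by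
    rw [← hXn]; gcongr
  have hNnu : (N : ℝ) ^ n ≤ 2 ^ n * (p : ℝ) ^ (α - β / 2) := by
    rw [← hXn, ← mul_pow]; gcongr
  obtain ⟨K, hK, hB⟩ := dual_card n p N hn hN1 h10 α β (2 ^ n) (by positivity) hNnu
  set A := cubeA p n N with hA
  have hNn : (0 : ℝ) < (N : ℝ) ^ n := by
    have : (0 : ℝ) < N := by exact_mod_cast hN1
    positivity
  have hpb0 := Real.rpow_pos_of_pos hpR (-(β / 2))
  have hpb : (p : ℝ) ^ (-(β / 2)) ≤ 1 := Real.rpow_le_one_of_one_le_of_nonpos hp1 (by linarith)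
  set t := c * (p : ℝ) ^ (-(β / 2)) with ht
  have ht0 : 0 < t := by positivity
  have ht1 : t ≤ 1 / 2 := by
    calc t ≤ c * 1 := by rw [ht]; gcongr
      _ ≤ _ := by linarith
  have hpn : (0 : ℝ) < (p : ℝ) ^ n := by positivity
  have hu0 : 0 < (1 - t) / (p : ℝ) ^ n := div_pos (by linarith) hpn
  refine ⟨N, K, fun x => (1 - t) / (p : ℝ) ^ n + (if x ∈ A then t / (N : ℝ) ^ n else 0),
    hK, ?_, ?_, ?_, ?_, ?_, hB⟩
  · intro x
    have : 0 ≤ (if x ∈ A then t / (N : ℝ) ^ n else 0) := by split_ifs <;> positivity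
    linarith
  · rw [Finset.sum_add_distrib, Finset.sum_ite_mem, Finset.sum_const, Finset.sum_const]
    simp only [Finset.univ_inter, Finset.card_univ, Fintype.card_pi, ZMod.card, Finset.prod_const,
      Fintype.card_fin, nsmul_eq_mul, hcard]
    push_cast
    field_simp
    ring
  · intro x
    have e1 : (1 - t) / (p : ℝ) ^ n ≤ C / 2 * (p : ℝ) ^ (-α) := by
      have : (p : ℝ) ^ (-(n - α)) * (p : ℝ) ^ (-α) = 1 / (p : ℝ) ^ n := by
        rw [← Real.rpow_add hpR, one_div, ← Real.rpow_natCast, ← Real.rpow_neg hpR.le]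
        congr 1; ring
      calc (1 - t) / (p : ℝ) ^ n ≤ 1 / (p : ℝ) ^ n := by gcongr; linarith
        _ = _ := this.symm
        _ ≤ _ := by gcongr
    have e2 : (if x ∈ A then t / (N : ℝ) ^ n else 0) ≤ C / 2 * (p : ℝ) ^ (-α) := by
      have hpa := Real.rpow_pos_of_pos hpR (-α)
      split_ifs
      · rw [div_le_iff₀ hNn]
        have : (p : ℝ) ^ (-α) * (p : ℝ) ^ (α - β / 2) = (p : ℝ) ^ (-(β / 2)) := by
          rw [← Real.rpow_add hpR]; congr 1; ring
        calc t ≤ C / 2 * (p : ℝ) ^ (-(β / 2)) := by rw [ht]; gcongr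
          _ = C / 2 * (p : ℝ) ^ (-α) * (p : ℝ) ^ (α - β / 2) := by rw [← this]; ring
          _ ≤ _ := by gcongr
      · positivity
    linarith
  · intro ξ hξ
    have e1 : dft (fun x => (((1 - t) / (p : ℝ) ^ n + (if x ∈ A then t / (N : ℝ) ^ n else 0) : ℝ)
        : ℂ)) ξ = ∑ x ∈ A, e p (-(∑ i, x i * ξ i)) * ((t / (N : ℝ) ^ n : ℝ) : ℂ) := by
      have : ∀ x : Fin n → ZMod p, e p (-(∑ i, x i * ξ i)) *
          (((1 - t) / (p : ℝ) ^ n + (if x ∈ A then t / (N : ℝ) ^ n else 0) : ℝ) : ℂ)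
          = e p (-(∑ i, x i * ξ i)) * (((1 - t) / (p : ℝ) ^ n : ℝ) : ℂ) +
            (if x ∈ A then e p (-(∑ i, x i * ξ i)) * ((t / (N : ℝ) ^ n : ℝ) : ℂ) else 0) := by
        intro x
        split_ifs
        · rw [Complex.ofReal_add, mul_add]
        · rw [add_zero, add_zero]
      rw [dft]
      simp_rw [this]
      rw [Finset.sum_add_distrib, ← Finset.sum_mul, sum_e_zero hξ, zero_mul, zero_add,
        Finset.sum_ite_mem, Finset.univ_inter]
    rw [e1]
    refine (norm_sum_le _ _).trans ?_
    simp_rw [norm_mul, norm_e, one_mul, Complex.norm_real]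
    rw [Finset.sum_const, nsmul_eq_mul, hcard, Real.norm_of_nonneg (by positivity),
      mul_div_cancel₀ _ hNn.ne', ht, neg_div]
    gcongr
    linarith
  · calc t = ∑ x ∈ A, t / (N : ℝ) ^ n := by
          rw [Finset.sum_const, nsmul_eq_mul, hcard, mul_div_cancel₀ _ hNn.ne']
      _ ≤ _ := Finset.sum_le_sum fun x hx => by
          simp only [hx, if_true]; linarith

lemma norm_ineq {p n N K : ℕ} [Fact p.Prime] (h : 10 * n * N * K ≤ p)
    (μ : (Fin n → ZMod p) → ℝ) (hμ : ∀ x, 0 ≤ μ x) (P Q : ℝ≥0∞) (hQ : 1 ≤ Q) (hQt : Q ≠ ⊤)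
    (C : ℝ) (hC : 0 < C)
    (hle : eLpNorm (dft (fun x => (if x ∈ cubeA p n N then (1 : ℂ) else 0) * μ x)) Q Measure.count
              ≤ ENNReal.ofReal C *
                  eLpNorm (fun x => (if x ∈ cubeA p n N then (1 : ℂ) else 0)) P
                    (Measure.count.withDensity fun x => ENNReal.ofReal (μ x))) :
    (∑ x ∈ cubeA p n N, μ x) * (1 / 2) * ((cubeA p n K).card : ℝ) ^ (1 / Q.toReal)
      ≤ C * (∑ x ∈ cubeA p n N, μ x) ^ (1 / P.toReal) := by
  set M := ∑ x ∈ cubeA p n N, μ x with hM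
  have hM0 : 0 ≤ M := Finset.sum_nonneg fun x _ => hμ x
  have hQ0 : Q ≠ 0 := (lt_of_lt_of_le one_pos hQ).ne'
  have hmeas : ∀ s : Set (Fin n → ZMod p), MeasurableSet s := fun s => trivial
  have h1 : ENNReal.ofReal (M * (1 / 2)) * ((cubeA p n K).card : ℝ≥0∞) ^ (1 / Q.toReal)
      ≤ eLpNorm (dft (fun x => (if x ∈ cubeA p n N then (1 : ℂ) else 0) * μ x)) Q
          Measure.count := by
    have e1 : eLpNorm ((cubeA p n K : Set (Fin n → ZMod p)).indicator
        (fun _ => (M * (1 / 2) : ℝ))) Q Measure.count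
        = ENNReal.ofReal (M * (1 / 2)) * ((cubeA p n K).card : ℝ≥0∞) ^ (1 / Q.toReal) := by
      rw [eLpNorm_indicator_const (hmeas _) hQ0 hQt, Measure.count_apply_finset' (hmeas _),
        Real.enorm_of_nonneg (by positivity)]
    rw [← e1]
    apply eLpNorm_mono
    intro ξ
    by_cases hξ : ξ ∈ cubeA p n K
    · rw [Set.indicator_of_mem (by exact_mod_cast hξ), Real.norm_of_nonneg (by positivity)]
      exact dft_lower h μ hμ hξ
    · rw [Set.indicator_of_notMem (by exact_mod_cast hξ)]
      simp
  have h2 : eLpNorm (fun x => (if x ∈ cubeA p n N then (1 : ℂ) else 0)) P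
      (Measure.count.withDensity fun x => ENNReal.ofReal (μ x))
      ≤ (ENNReal.ofReal M) ^ (1 / P.toReal) := by
    have e1 : (fun x => (if x ∈ cubeA p n N then (1 : ℂ) else 0))
        = (cubeA p n N : Set (Fin n → ZMod p)).indicator (fun _ => (1 : ℂ)) := by
      funext x
      simp [Set.indicator_apply]
    rw [e1]
    refine (eLpNorm_indicator_const_le _ _).trans ?_
    rw [withDensity_apply _ (hmeas _), enorm_one, one_mul]
    apply le_of_eq
    congr 1
    haveI : MeasurableSingletonClass (Fin n → ZMod p) := ⟨fun _ => trivial⟩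
    rw [lintegral_finset, hM, ENNReal.ofReal_sum_of_nonneg fun x _ => hμ x]
    simp
  have h3 := (h1.trans hle).trans (mul_le_mul_right h2 _)
  rw [← ENNReal.ofReal_natCast, ENNReal.ofReal_rpow_of_nonneg (by positivity) (by positivity),
    ENNReal.ofReal_rpow_of_nonneg hM0 (by positivity), ← ENNReal.ofReal_mul (by positivity),
    ← ENNReal.ofReal_mul (by positivity)] at h3
  exact (ENNReal.ofReal_le_ofReal_iff (by positivity)).1 h3

lemma exponent_le (n : ℕ) (α β : ℝ)
    (hβ0 : 0 < β) (hβα : β ≤ α) (hαn : α < n) (hn : 1 ≤ n) (P Q : ℝ≥0∞) (hP : 1 ≤ P) (hQ : 1 ≤ Q)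
    (hQt : Q ≠ ⊤)
    (H : ∃ C : ℝ, 0 < C ∧
        ∀ (p : ℕ) [Fact p.Prime] (μ : (Fin n → ZMod p) → ℝ),
          (∀ x, 0 ≤ μ x) → (∑ x, μ x) = 1 →
          (∀ x, μ x ≤ C * (p : ℝ) ^ (-α)) →
          (∀ ξ, ξ ≠ 0 → ‖dft (fun x => (μ x : ℂ)) ξ‖ ≤ C * (p : ℝ) ^ (-β / 2)) →
          ∀ f : (Fin n → ZMod p) → ℂ, (∀ x, μ x = 0 → f x = 0) →
            eLpNorm (dft (fun x => f x * μ x)) Q Measure.count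
              ≤ ENNReal.ofReal C *
                  eLpNorm f P
                    (Measure.count.withDensity fun x => ENNReal.ofReal (μ x))) :
    (n - α + β / 2) * (1 / Q.toReal) ≤ β / 2 * (1 - 1 / P.toReal) := by
  obtain ⟨C, hC, H⟩ := H
  obtain ⟨m, b, hm, hb, hev⟩ := construct n α β C hβ0 hβα hαn hn hC
  by_contra hcon
  push Not at hcon
  set γ := (n - α + β / 2) * (1 / Q.toReal) - β / 2 * (1 - 1 / P.toReal) with hγ
  have hγ0 : 0 < γ := by linarith
  set d := 1 / 2 * m ^ (1 - 1 / P.toReal) * b ^ (1 / Q.toReal) with hd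
  have hd0 : 0 < d := by positivity
  have hev2 := eventually_small γ (d / (2 * C)) hγ0 (by positivity)
  obtain ⟨p₁, hp₁⟩ := Filter.eventually_atTop.1 (hev.and hev2)
  obtain ⟨p, hpge, hpp⟩ := Nat.exists_infinite_primes p₁
  obtain ⟨h1, h2⟩ := hp₁ p hpge
  haveI : Fact p.Prime := ⟨hpp⟩
  obtain ⟨N, K, μ, hK, hμ, hs, hbd, hft, hM, hB⟩ := h1 ⟨hpp⟩
  have hpR : (0 : ℝ) < p := by exact_mod_cast hpp.pos
  have h3 := norm_ineq hK μ (fun x => (hμ x).le) P Q hQ hQt C hC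
    (H p μ (fun x => (hμ x).le) hs hbd hft _ (fun x hx => absurd hx (hμ x).ne'))
  have hs1 : 1 / P.toReal ≤ 1 := by
    by_cases hPt : P = ⊤
    · simp [hPt]
    · have : 1 ≤ P.toReal := by
        rw [← ENNReal.toReal_one]; exact ENNReal.toReal_mono hPt hP
      rw [div_le_one (by linarith)]; exact this
  have h4 := (power_combine (s := 1 / P.toReal) (r := 1 / Q.toReal) hpR hm hb hM hB hs1
    (by positivity)).trans h3
  have hM0 : 0 < ∑ x ∈ cubeA p n N, μ x := lt_of_lt_of_le (by positivity) hM
  have h5 := le_of_mul_le_mul_right h4 (Real.rpow_pos_of_pos hM0 _)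
  rw [← hγ, ← hd] at h5
  rw [Real.rpow_neg hpR.le] at h2
  have hpg := Real.rpow_pos_of_pos hpR γ
  rw [inv_le_comm₀ hpg (by positivity), inv_div, div_le_iff₀ hd0] at h2
  linarith

/-- Necessary conditions for `R*(p₀ → q) ≲ 1`.  First, for the measure
`μ = (1_E + 1_A)/(|E|+|A|)` of the sharpness construction and `f = 1_A`, for
all `1 ≤ p₀ < ∞` one has
`‖(fμ)^∧‖_{L^q} ≥ c p^{(2n-2α+β-qβ)/(2q) + β/(2p₀)} ‖f‖_{L^{p₀}(μ)}`.
Consequently, for probability measures `μ` with `μ(x) ≲ p^{-α}` and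
`|μ̂(ξ)| ≲ p^{-β/2}` (`ξ ≠ 0`), a uniform bound `R*(p₀ → q) ≲ 1` forces
`q ≥ p₀(2n-2α+β)/((p₀-1)β)` for `1 < p₀ < ∞`, `q ≥ (2n-2α+β)/β` for `p₀ = ∞`,
and `q = ∞` for `p₀ = 1`. -/
theorem necessary_conditions (n : ℕ) (α β c₁ c₂ c₃ c₄ : ℝ)
    (hβ0 : 0 < β) (hβα : β ≤ α) (hαn : α < n)
    (hc₁ : 0 < c₁) (hc₂ : 0 < c₂) (hc₃ : 0 < c₃) (hc₄ : 0 < c₄) :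
    (∀ p₀ q : ℝ, 1 ≤ p₀ → 1 ≤ q →
      ∃ c : ℝ, 0 < c ∧
        ∀ (p N : ℕ) [Fact p.Prime] (E : Finset (Fin n → ZMod p)),
          1 ≤ N → 10 * n * N ≤ p →
          c₁ * (p : ℝ) ^ (α - β / 2) ≤ (N : ℝ) ^ n →
          (N : ℝ) ^ n ≤ c₂ * (p : ℝ) ^ (α - β / 2) →
          c₃ * (p : ℝ) ^ α ≤ (E.card : ℝ) →
          (E.card : ℝ) ≤ c₄ * (p : ℝ) ^ α →
          ((E ∩ cubeA p n N).card : ℝ) ≤ ((cubeA p n N).card : ℝ) / 100 →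
          c * (p : ℝ) ^ ((2 * n - 2 * α + β - q * β) / (2 * q) + β / (2 * p₀)) *
              (∑ x : Fin n → ZMod p,
                ‖(if x ∈ cubeA p n N then (1 : ℂ) else 0)‖ ^ p₀ *
                  combMeasure p n N E x) ^ (1 / p₀)
            ≤ (∑ ξ : Fin n → ZMod p,
                ‖dft (fun x => (if x ∈ cubeA p n N then (1 : ℂ) else 0) *
                    combMeasure p n N E x) ξ‖ ^ q) ^ (1 / q))
    ∧
    (∀ P Q : ℝ≥0∞, 1 ≤ P → 1 ≤ Q →
      (∃ C : ℝ, 0 < C ∧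
        ∀ (p : ℕ) [Fact p.Prime] (μ : (Fin n → ZMod p) → ℝ),
          (∀ x, 0 ≤ μ x) → (∑ x, μ x) = 1 →
          (∀ x, μ x ≤ C * (p : ℝ) ^ (-α)) →
          (∀ ξ, ξ ≠ 0 → ‖dft (fun x => (μ x : ℂ)) ξ‖ ≤ C * (p : ℝ) ^ (-β / 2)) →
          ∀ f : (Fin n → ZMod p) → ℂ, (∀ x, μ x = 0 → f x = 0) →
            eLpNorm (dft (fun x => f x * μ x)) Q Measure.count
              ≤ ENNReal.ofReal C *
                  eLpNorm f P
                    (Measure.count.withDensity fun x => ENNReal.ofReal (μ x))) →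
      (if P = 1 then ⊤
       else if P = ⊤ then ENNReal.ofReal ((2 * n - 2 * α + β) / β)
       else ENNReal.ofReal
          (P.toReal * (2 * n - 2 * α + β) / ((P.toReal - 1) * β))) ≤ Q) := by
  have hn : 1 ≤ n := by
    rcases Nat.eq_zero_or_pos n with h | h
    · subst h; norm_num at hαn; linarith
    · exact h
  refine ⟨?_, ?_⟩
  · intro p₀ q hp₀ hq
    obtain ⟨c, hc, h⟩ := part_one n α β c₁ c₂ c₄ hβ0 hn hc₁ hc₂ hc₄ p₀ q hp₀ hq
    exact ⟨c, hc, fun p N _ E h1 h2 h3 h4 _ h6 _ => h p N E h1 h2 h3 h4 h6⟩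
  · intro P Q hP hQ H
    by_cases hQt : Q = ⊤
    · rw [hQt]; exact le_top
    have hk := exponent_le n α β hβ0 hβα hαn hn P Q hP hQ hQt H
    have hQ1 : 1 ≤ Q.toReal := by
      rw [← ENNReal.toReal_one]; exact ENNReal.toReal_mono hQt hQ
    have hQ0 : 0 < Q.toReal := by linarith
    rw [mul_one_div, div_le_iff₀ hQ0] at hk
    split_ifs with h1 h2
    · exfalso
      rw [h1] at hk
      norm_num at hk
      linarith
    · rw [h2] at hk
      norm_num at hk
      apply ENNReal.ofReal_le_of_le_toReal
      rw [div_le_iff₀ hβ0]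
      linarith
    · have hP1 : 1 < P.toReal := by
        rw [← ENNReal.toReal_one]
        exact (ENNReal.toReal_lt_toReal one_ne_top h2).2 (lt_of_le_of_ne hP (Ne.symm h1))
      apply ENNReal.ofReal_le_of_le_toReal
      have hP0 : 0 < P.toReal := by linarith
      rw [div_le_iff₀ (mul_pos (by linarith) hβ0)]
      have : β / 2 * (1 - 1 / P.toReal) * Q.toReal * (2 * P.toReal)
          = Q.toReal * ((P.toReal - 1) * β) := by
        field_simp
      rw [← this]
      nlinarith
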